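/- arXiv:1809.07583 — 2 statements merged into one kernel-verified Lean document; each statement's English description precedes it below -/
import Mathlib

section
/- Let T > 0, let α > 0, β > 0 and a, b ≥ 0 be constants, and let φ : (0, T] → [0, ∞) be continuous on (0, T] and integrable on (0, T). If for every t ∈ (0, T] one has φ(t) ≤ a·t^(α−1) + b·∫₀ᵗ (t − s)^(β−1) φ(s) ds, then there exists a constant c = c(b, T, α, β), independent of a and of t, such that φ(t) ≤ c·a·t^(α−1) for all t ∈ (0, T]. -/
open MeasureTheory Set

open scoped ENNReal

/-- The one-sided power kernel `x ↦ x ^ (γ - 1)` on `(0, ∞)`, extended by zero. -/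
noncomputable def powKernel (γ : ℝ) : ℝ → ℝ≥0∞ :=
  (Ioi (0 : ℝ)).indicator fun x ↦ ENNReal.ofReal (x ^ (γ - 1))

lemma powKernel_of_pos {γ x : ℝ} (hx : 0 < x) :
    powKernel γ x = ENNReal.ofReal (x ^ (γ - 1)) :=
  indicator_of_mem (s := Ioi (0 : ℝ)) hx _

lemma powKernel_of_nonpos {γ x : ℝ} (hx : x ≤ 0) : powKernel γ x = 0 :=
  indicator_of_notMem (s := Ioi (0 : ℝ)) (not_lt.2 hx) _

@[fun_prop]
lemma measurable_powKernel (γ : ℝ) : Measurable (powKernel γ) :=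
  Measurable.indicator (by fun_prop) measurableSet_Ioi

lemma powKernel_lconvolution_apply_of_pos {γ α x : ℝ} (hγ : 0 < γ) (hα : 0 < α) (hx : 0 < x) :
    (powKernel γ ⋆ₗ powKernel α) x =
      ENNReal.ofReal (ProbabilityTheory.beta γ α) * powKernel (γ + α) x := by
  have hB := ProbabilityTheory.beta_pos hγ hα
  have hscale : ∀ u : ℝ, powKernel γ (x * u) * powKernel α (-(x * u) + x) =
      ENNReal.ofReal (ProbabilityTheory.beta γ α * x ^ (γ + α - 2)) *
        ProbabilityTheory.betaPDF γ α u := by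
    intro u
    rcases le_or_gt u 0 with hu | hu
    · rw [powKernel_of_nonpos (by nlinarith), ProbabilityTheory.betaPDF_eq_zero_of_nonpos hu]
      simp
    rcases le_or_gt 1 u with hu1 | hu1
    · rw [powKernel_of_nonpos (γ := α) (by nlinarith),
        ProbabilityTheory.betaPDF_eq_zero_of_one_le hu1]
      simp
    have h1 : 0 < 1 - u := by linarith
    have h2 : -(x * u) + x = x * (1 - u) := by ring
    rw [h2, powKernel_of_pos (by positivity), powKernel_of_pos (by positivity),
      ProbabilityTheory.betaPDF_of_pos_lt_one hu hu1, ← ENNReal.ofReal_mul (by positivity),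
      ← ENNReal.ofReal_mul (by positivity), Real.mul_rpow hx.le hu.le,
      Real.mul_rpow hx.le h1.le, show γ + α - 2 = (γ - 1) + (α - 1) by ring, Real.rpow_add hx]
    congr 1
    field_simp
  rw [lconvolution_def, ← Real.smul_map_volume_mul_left hx.ne', lintegral_smul_measure,
    lintegral_map (by fun_prop) (by fun_prop)]
  simp_rw [hscale]
  rw [lintegral_const_mul' _ _ ENNReal.ofReal_ne_top,
    ProbabilityTheory.lintegral_betaPDF_eq_one hγ hα, powKernel_of_pos hx, abs_of_pos hx, mul_one,
    smul_eq_mul, ← ENNReal.ofReal_mul hx.le, ← ENNReal.ofReal_mul hB.le,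
    show γ + α - 1 = (γ + α - 2) + 1 by ring, Real.rpow_add_one hx.ne']
  congr 1
  ring

lemma powKernel_lconvolution_powKernel {γ α : ℝ} (hγ : 0 < γ) (hα : 0 < α) :
    powKernel γ ⋆ₗ powKernel α =
      fun x ↦ ENNReal.ofReal (ProbabilityTheory.beta γ α) * powKernel (γ + α) x := by
  ext x
  rcases le_or_gt x 0 with hx | hx
  · rw [powKernel_of_nonpos hx, mul_zero, lconvolution_def]
    refine lintegral_eq_zero_of_ae_eq_zero (.of_forall fun y ↦ ?_)
    rcases le_or_gt y 0 with hy | hy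
    · simp [powKernel_of_nonpos hy]
    · simp [powKernel_of_nonpos (show -y + x ≤ 0 by linarith)]
  · exact powKernel_lconvolution_apply_of_pos hγ hα hx

lemma lintegral_lconvolution {f g : ℝ → ℝ≥0∞} (hf : Measurable f) (hg : Measurable g) :
    ∫⁻ x, (f ⋆ₗ g) x = (∫⁻ x, f x) * ∫⁻ x, g x := by
  simp_rw [lconvolution_def]
  rw [lintegral_lintegral_swap (by fun_prop)]
  have h : ∀ y, ∫⁻ x, f y * g (-y + x) = f y * ∫⁻ x, g x := fun y ↦ by
    rw [lintegral_const_mul _ (by fun_prop), lintegral_add_left_eq_self]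
  simp_rw [h]
  exact lintegral_mul_const _ hf

lemma lintegral_le_two_mul_of_le_add_lconvolution {g h K : ℝ → ℝ≥0∞} (hg : Measurable g)
    (hh : Measurable h) (hK : Measurable K) (hgK : ∀ x, g x ≤ h x + (K ⋆ₗ g) x)
    (hK_half : ∫⁻ x, K x ≤ 2⁻¹) (hg_top : ∫⁻ x, g x ≠ ∞) :
    ∫⁻ x, g x ≤ 2 * ∫⁻ x, h x := by
  have h1 : ∫⁻ x, g x ≤ (∫⁻ x, h x) + 2⁻¹ * ∫⁻ x, g x := by
    calc ∫⁻ x, g x ≤ ∫⁻ x, (h x + (K ⋆ₗ g) x) := lintegral_mono hgK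
      _ = (∫⁻ x, h x) + (∫⁻ x, K x) * ∫⁻ x, g x := by
        rw [lintegral_add_left hh, lintegral_lconvolution hK hg]
      _ ≤ _ := by gcongr
  generalize ∫⁻ x, g x = G at *
  generalize ∫⁻ x, h x = H at *
  rcases eq_or_ne H ∞ with rfl | hH
  · simp
  lift G to NNReal using hg_top
  lift H to NNReal using hH
  have h2 : (2⁻¹ : ℝ≥0∞) = ((2⁻¹ : NNReal) : ℝ≥0∞) := by simp
  rw [h2] at h1
  norm_cast at h1 ⊢
  rw [← NNReal.coe_le_coe] at h1 ⊢
  push_cast at h1 ⊢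
  linarith

lemma lintegral_exp_neg_mul_powKernel {β l : ℝ} (hβ : 0 < β) (hl : 0 < l) :
    ∫⁻ x, ENNReal.ofReal (Real.exp (-(l * x))) * powKernel β x =
      ENNReal.ofReal (Real.Gamma β / l ^ β) := by
  have hΓ := Real.Gamma_pos_of_pos hβ
  have h : ∀ᵐ x : ℝ, ENNReal.ofReal (Real.exp (-(l * x))) * powKernel β x =
      ENNReal.ofReal (Real.Gamma β / l ^ β) * ProbabilityTheory.gammaPDF β l x := by
    filter_upwards [Measure.ae_ne volume (0 : ℝ)] with x hx0
    rcases hx0.lt_or_gt with hx | hx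
    · rw [powKernel_of_nonpos hx.le, ProbabilityTheory.gammaPDF_of_neg hx, mul_zero, mul_zero]
    · rw [powKernel_of_pos hx, ProbabilityTheory.gammaPDF_of_nonneg hx.le,
        ← ENNReal.ofReal_mul (by positivity), ← ENNReal.ofReal_mul (by positivity)]
      congr 1
      field_simp
  rw [lintegral_congr_ae h, lintegral_const_mul' _ _ ENNReal.ofReal_ne_top,
    ProbabilityTheory.lintegral_gammaPDF_eq_one hβ hl, mul_one]

lemma lintegral_Iic_powKernel {α t : ℝ} (hα : 0 < α) (ht : 0 ≤ t) :
    ∫⁻ x in Iic t, powKernel α x = ENNReal.ofReal (t ^ α / α) := by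
  have h := intervalIntegral.intervalIntegrable_rpow' (a := 0) (b := t)
    (show -1 < α - 1 by linarith)
  rw [intervalIntegrable_iff_integrableOn_Ioc_of_le ht] at h
  unfold powKernel
  rw [setLIntegral_indicator measurableSet_Ioi, Ioi_inter_Iic,
    ← ofReal_integral_eq_lintegral_ofReal h, ← intervalIntegral.integral_of_le ht,
    integral_rpow (Or.inl (by linarith))]
  · simp [hα.ne']
  · filter_upwards [ae_restrict_mem measurableSet_Ioc] with x hx
    exact Real.rpow_nonneg hx.1.le _

lemma exp_mul_lconvolution (l x : ℝ) (f g : ℝ → ℝ≥0∞) :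
    ENNReal.ofReal (Real.exp (-(l * x))) * (f ⋆ₗ g) x =
      ((fun y ↦ ENNReal.ofReal (Real.exp (-(l * y))) * f y) ⋆ₗ
        fun y ↦ ENNReal.ofReal (Real.exp (-(l * y))) * g y) x := by
  rw [lconvolution_def, lconvolution_def, ← lintegral_const_mul' _ _ ENNReal.ofReal_ne_top]
  refine lintegral_congr fun y ↦ ?_
  have : Real.exp (-(l * x)) = Real.exp (-(l * y)) * Real.exp (-(l * (-y + x))) := by
    rw [← Real.exp_add]; ring_nf
  rw [this, ENNReal.ofReal_mul (Real.exp_nonneg _)]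
  ring

/-- `f` is supported in `(0, T]`, has finite integral, and satisfies the inequality
`f ≤ A x ^ (α - 1) + B ∫ (x - s) ^ (β - 1) f(s) ds`. -/
structure IsGronwallSubsolution (T α β : ℝ) (B A : ℝ≥0∞) (f : ℝ → ℝ≥0∞) : Prop where
  measurable : Measurable f
  eq_zero : ∀ x, x ∉ Ioc 0 T → f x = 0
  lintegral_ne_top : ∫⁻ x, f x ≠ ∞
  le : ∀ x, f x ≤ A * powKernel α x + B * (powKernel β ⋆ₗ f) x

lemma exists_ofReal_mul_Gamma_div_rpow_le {b β : ℝ} (hb : 0 ≤ b) (hβ : 0 < β) :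
    ∃ l : ℝ, 0 < l ∧ ENNReal.ofReal b * ENNReal.ofReal (Real.Gamma β / l ^ β) ≤ 2⁻¹ := by
  have hΓ := Real.Gamma_pos_of_pos hβ
  have hD : 0 < 2 * b * Real.Gamma β + 1 := by positivity
  refine ⟨(2 * b * Real.Gamma β + 1) ^ (β⁻¹), by positivity, ?_⟩
  rw [Real.rpow_inv_rpow hD.le hβ.ne', ← ENNReal.ofReal_mul hb,
    show (2⁻¹ : ℝ≥0∞) = ENNReal.ofReal 2⁻¹ by
      rw [ENNReal.ofReal_inv_of_pos two_pos, ENNReal.ofReal_ofNat]]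
  apply ENNReal.ofReal_le_ofReal
  rw [← mul_div_assoc, div_le_iff₀ hD]
  linarith

lemma IsGronwallSubsolution.exists_setLIntegral_Iic_le (T : ℝ) {b α β : ℝ} (hb : 0 ≤ b)
    (hα : 0 < α) (hβ : 0 < β) :
    ∃ C : ℝ≥0∞, C ≠ ∞ ∧ ∀ A f, IsGronwallSubsolution T α β (ENNReal.ofReal b) A f →
      ∀ t ∈ Ioc 0 T, ∫⁻ x in Iic t, f x ≤ C * A * ENNReal.ofReal (t ^ α) := by
  obtain ⟨l, hl, hlb⟩ := exists_ofReal_mul_Gamma_div_rpow_le hb hβ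
  refine ⟨ENNReal.ofReal (Real.exp (l * T)) * 2 * ENNReal.ofReal α⁻¹, by finiteness, ?_⟩
  rintro A f hf t ⟨ht, htT⟩
  have hfm := hf.measurable
  set B := ENNReal.ofReal b
  set e : ℝ → ℝ≥0∞ := fun x ↦ ENNReal.ofReal (Real.exp (-(l * x))) with he
  have he_meas : Measurable e := by fun_prop
  have he_le : ∀ x, 0 < x → e x ≤ 1 := fun x hx ↦ by
    rw [he, ENNReal.ofReal_le_one, Real.exp_le_one_iff]
    nlinarith
  set F : ℝ → ℝ≥0∞ := (Iic t).indicator f with hF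
  have hFm : Measurable F := hfm.indicator measurableSet_Iic
  have hconv : ∀ x ≤ t, (powKernel β ⋆ₗ f) x = (powKernel β ⋆ₗ F) x := fun x hx ↦ by
    refine lintegral_congr fun y ↦ ?_
    rcases le_or_gt y 0 with hy | hy
    · simp [powKernel_of_nonpos hy]
    · rw [hF, indicator_of_mem (show -y + x ∈ Iic t by rw [mem_Iic]; linarith)]
  have hmain : ∫⁻ x, e x * F x ≤ 2 * ∫⁻ x, (Iic t).indicator (fun x ↦ A * powKernel α x) x := by
    refine lintegral_le_two_mul_of_le_add_lconvolution (K := fun x ↦ B * (e x * powKernel β x))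
      (by fun_prop) (Measurable.indicator (by fun_prop) measurableSet_Iic) (by fun_prop) ?_ ?_ ?_
    · intro x
      rcases le_or_gt x t with hx | hx
      · rw [hF, indicator_of_mem (show x ∈ Iic t from hx),
          indicator_of_mem (show x ∈ Iic t from hx)]
        refine (mul_le_mul_right (hf.le x) _).trans ?_
        rw [mul_add]
        refine add_le_add ?_ (le_of_eq ?_)
        · rcases le_or_gt x 0 with hx0 | hx0
          · simp [powKernel_of_nonpos hx0]
          · exact mul_le_of_le_one_left' (he_le x hx0)
        · rw [hconv x hx, mul_left_comm, exp_mul_lconvolution, lconvolution_def, lconvolution_def,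
            ← lintegral_const_mul' _ _ ENNReal.ofReal_ne_top]
          simp only [mul_assoc]
          rfl
      · simp [hF, hx]
    · rw [lintegral_const_mul' _ _ ENNReal.ofReal_ne_top, lintegral_exp_neg_mul_powKernel hβ hl]
      exact hlb
    · refine ne_top_of_le_ne_top hf.lintegral_ne_top (lintegral_mono fun x ↦ ?_)
      rcases le_or_gt x 0 with hx0 | hx0
      · have : F x = 0 := by
          rw [hF, indicator_apply, hf.eq_zero x fun h ↦ hx0.not_gt h.1, ite_self]
        simp [this]
      · exact (mul_le_of_le_one_left' (he_le x hx0)).trans (indicator_le_self _ _ x)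
  rw [lintegral_indicator measurableSet_Iic, lintegral_const_mul _ (measurable_powKernel α),
    lintegral_Iic_powKernel hα ht.le] at hmain
  calc ∫⁻ x in Iic t, f x = ∫⁻ x, F x := (lintegral_indicator measurableSet_Iic f).symm
    _ ≤ ∫⁻ x, ENNReal.ofReal (Real.exp (l * T)) * (e x * F x) := by
      refine lintegral_mono fun x ↦ ?_
      rcases le_or_gt x t with hx | hx
      · rw [← mul_assoc, he, ← ENNReal.ofReal_mul (Real.exp_nonneg _), ← Real.exp_add]
        refine le_mul_of_one_le_left' ?_
        rw [ENNReal.one_le_ofReal, Real.one_le_exp_iff]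
        nlinarith
      · simp [hF, hx]
    _ = ENNReal.ofReal (Real.exp (l * T)) * ∫⁻ x, e x * F x :=
      lintegral_const_mul' _ _ ENNReal.ofReal_ne_top
    _ ≤ ENNReal.ofReal (Real.exp (l * T)) * (2 * (A * ENNReal.ofReal (t ^ α / α))) := by gcongr
    _ = _ := by
      rw [div_eq_mul_inv, ENNReal.ofReal_mul (by positivity)]
      ring

lemma IsGronwallSubsolution.exists_powKernel_lconvolution_le_of_one_le (T : ℝ) {b α β γ : ℝ}
    (hb : 0 ≤ b) (hα : 0 < α) (hβ : 0 < β) (hγ : 1 ≤ γ) :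
    ∃ C : ℝ≥0∞, C ≠ ∞ ∧ ∀ A f, IsGronwallSubsolution T α β (ENNReal.ofReal b) A f →
      ∀ t ∈ Ioc 0 T, (powKernel γ ⋆ₗ f) t ≤ C * A * powKernel (γ + α) t := by
  obtain ⟨C, hC, h⟩ := IsGronwallSubsolution.exists_setLIntegral_Iic_le T hb hα hβ
  refine ⟨C, hC, fun A f hf t ht ↦ ?_⟩
  have ht0 := ht.1
  calc (powKernel γ ⋆ₗ f) t
      ≤ ∫⁻ y, ENNReal.ofReal (t ^ (γ - 1)) * (Iic t).indicator f (t - y) := by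
        rw [lconvolution_def]
        refine lintegral_mono fun y ↦ ?_
        rw [neg_add_eq_sub]
        rcases le_or_gt y 0 with hy | hy
        · simp [powKernel_of_nonpos hy]
        rcases le_or_gt t y with hyt | hyt
        · rw [hf.eq_zero _ fun h ↦ by linarith [h.1]]
          simp
        rw [indicator_of_mem (show t - y ∈ Iic t by rw [mem_Iic]; linarith), powKernel_of_pos hy]
        gcongr
    _ = ENNReal.ofReal (t ^ (γ - 1)) * ∫⁻ x in Iic t, f x := by
        rw [lintegral_const_mul' _ _ ENNReal.ofReal_ne_top,
          lintegral_sub_left_eq_self (fun y ↦ (Iic t).indicator f y) t,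
          lintegral_indicator measurableSet_Iic]
    _ ≤ ENNReal.ofReal (t ^ (γ - 1)) * (C * A * ENNReal.ofReal (t ^ α)) := by
        gcongr
        exact h A f hf t ht
    _ = C * A * powKernel (γ + α) t := by
        rw [powKernel_of_pos ht0, show γ + α - 1 = (γ - 1) + α by ring, Real.rpow_add ht0,
          ENNReal.ofReal_mul (by positivity)]
        ring

lemma powKernel_add_le {γ β t T : ℝ} (hβ : 0 < β) (ht : t ∈ Ioc 0 T) :
    powKernel (γ + β) t ≤ ENNReal.ofReal (T ^ β) * powKernel γ t := by
  have ht0 := ht.1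
  rw [powKernel_of_pos ht0, powKernel_of_pos ht0, show γ + β - 1 = β + (γ - 1) by ring,
    Real.rpow_add ht0, ENNReal.ofReal_mul (by positivity)]
  gcongr
  exact ht.2

lemma IsGronwallSubsolution.powKernel_lconvolution_le {T α β γ t : ℝ} {B A : ℝ≥0∞}
    {f : ℝ → ℝ≥0∞} (hf : IsGronwallSubsolution T α β B A f) (hα : 0 < α) (hβ : 0 < β)
    (hγ : 0 < γ) :
    (powKernel γ ⋆ₗ f) t ≤ A * (ENNReal.ofReal (ProbabilityTheory.beta γ α) * powKernel (γ + α) t) +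
      B * (ENNReal.ofReal (ProbabilityTheory.beta γ β) * (powKernel (γ + β) ⋆ₗ f) t) := by
  have hfm := hf.measurable
  have h1 : (powKernel γ ⋆ₗ powKernel β ⋆ₗ f) t =
      ENNReal.ofReal (ProbabilityTheory.beta γ β) * (powKernel (γ + β) ⋆ₗ f) t := by
    rw [lconvolution_assoc (by fun_prop) (by fun_prop) hfm,
      powKernel_lconvolution_powKernel hγ hβ, lconvolution_def, lconvolution_def,
      ← lintegral_const_mul' _ _ ENNReal.ofReal_ne_top]
    simp only [mul_assoc]
  rw [← h1, ← congrFun (powKernel_lconvolution_powKernel hγ hα) t, lconvolution_def,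
    lconvolution_def, lconvolution_def, ← lintegral_const_mul _ (by fun_prop),
    ← lintegral_const_mul _ (by fun_prop), ← lintegral_add_left (by fun_prop)]
  refine lintegral_mono fun y ↦ (mul_le_mul_right (hf.le (-y + t)) _).trans (le_of_eq ?_)
  ring

lemma IsGronwallSubsolution.exists_powKernel_lconvolution_le (T : ℝ) {b α β γ : ℝ} (hb : 0 ≤ b)
    (hα : 0 < α) (hβ : 0 < β) (hγ : 0 < γ) :
    ∃ C : ℝ≥0∞, C ≠ ∞ ∧ ∀ A f, IsGronwallSubsolution T α β (ENNReal.ofReal b) A f →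
      ∀ t ∈ Ioc 0 T, (powKernel γ ⋆ₗ f) t ≤ C * A * powKernel (γ + α) t := by
  obtain ⟨n, hn⟩ := exists_nat_ge (1 / β)
  replace hn : 1 ≤ γ + n * β := by
    rw [div_le_iff₀ hβ] at hn
    linarith
  induction n generalizing γ with
  | zero => exact exists_powKernel_lconvolution_le_of_one_le T hb hα hβ (by simpa using hn)
  | succ n ih =>
    obtain ⟨C, hC, h⟩ := ih (γ := γ + β) (by positivity) (by push_cast at hn; linarith)
    refine ⟨ENNReal.ofReal (ProbabilityTheory.beta γ α) + ENNReal.ofReal b *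
      (ENNReal.ofReal (ProbabilityTheory.beta γ β) * (C * ENNReal.ofReal (T ^ β))),
      by finiteness, fun A f hf t ht ↦ ?_⟩
    refine (hf.powKernel_lconvolution_le hα hβ hγ).trans ?_
    have hk : (powKernel (γ + β) ⋆ₗ f) t ≤ C * A * (ENNReal.ofReal (T ^ β) *
        powKernel (γ + α) t) := by
      refine (h A f hf t ht).trans ?_
      rw [add_right_comm]
      gcongr
      exact powKernel_add_le hβ ht
    grw [hk]
    apply le_of_eq
    ring

lemma IsGronwallSubsolution.exists_le (T : ℝ) {b α β : ℝ} (hb : 0 ≤ b) (hα : 0 < α)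
    (hβ : 0 < β) :
    ∃ C : ℝ≥0∞, C ≠ ∞ ∧ ∀ A f, IsGronwallSubsolution T α β (ENNReal.ofReal b) A f →
      ∀ t ∈ Ioc 0 T, f t ≤ C * A * powKernel α t := by
  obtain ⟨C, hC, h⟩ := exists_powKernel_lconvolution_le T hb hα hβ hβ
  refine ⟨1 + ENNReal.ofReal b * (C * ENNReal.ofReal (T ^ β)), by finiteness,
    fun A f hf t ht ↦ ?_⟩
  have hk := powKernel_add_le (γ := α) hβ ht
  have h' := h A f hf t ht
  rw [add_comm β α] at h'
  grw [hf.le t, h', hk]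
  apply le_of_eq
  ring

lemma isGronwallSubsolution_indicator_ofReal {T b α β a : ℝ} {φ : ℝ → ℝ} (hb : 0 ≤ b)
    (ha : 0 ≤ a) (hφ : ContinuousOn φ (Ioc 0 T)) (hφ_nonneg : ∀ t ∈ Ioc 0 T, 0 ≤ φ t)
    (hφ_int : IntegrableOn φ (Ioo 0 T))
    (h : ∀ t ∈ Ioc 0 T,
      φ t ≤ a * t ^ (α - 1) + b * ∫ s in Ioo (0 : ℝ) t, (t - s) ^ (β - 1) * φ s) :
    IsGronwallSubsolution T α β (ENNReal.ofReal b) (ENNReal.ofReal a)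
      ((Ioc 0 T).indicator fun x ↦ ENNReal.ofReal (φ x)) where
  measurable := by
    have h1 : Measurable ((Ioc 0 T).indicator φ) := by
      classical
      rw [← piecewise_eq_indicator]
      exact hφ.measurable_piecewise continuousOn_const measurableSet_Ioc
    convert h1.ennreal_ofReal using 1
    ext x
    by_cases hx : x ∈ Ioc 0 T <;> simp [hx]
  eq_zero x hx := indicator_of_notMem hx _
  lintegral_ne_top := by
    rw [lintegral_indicator measurableSet_Ioc, setLIntegral_congr Ioo_ae_eq_Ioc.symm]
    exact (Integrable.lintegral_lt_top hφ_int).ne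
  le x := by
    by_cases hx : x ∈ Ioc 0 T
    swap
    · simp [hx]
    rw [indicator_of_mem hx, powKernel_of_pos hx.1]
    have hx0 := hx.1
    refine (ENNReal.ofReal_le_ofReal (h x hx)).trans (ENNReal.ofReal_add_le.trans ?_)
    rw [ENNReal.ofReal_mul ha, ENNReal.ofReal_mul hb]
    gcongr
    refine (Real.ofReal_le_enorm _).trans ((enorm_integral_le_lintegral_enorm _).trans ?_)
    rw [lconvolution_comm, lconvolution_def, ← lintegral_indicator measurableSet_Ioo]
    refine lintegral_mono fun s ↦ ?_
    by_cases hs : s ∈ Ioo 0 x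
    swap
    · simp [hs]
    have hsx : 0 < x - s := sub_pos.2 hs.2
    have hsT : s ∈ Ioc 0 T := ⟨hs.1, hs.2.le.trans hx.2⟩
    have hφs := hφ_nonneg s hsT
    rw [indicator_of_mem hs, indicator_of_mem hsT, neg_add_eq_sub, powKernel_of_pos hsx,
      Real.enorm_eq_ofReal (by positivity), mul_comm, ENNReal.ofReal_mul hφs]

/-- Generalized (weakly singular) Gronwall inequality of Henry type. -/
theorem generalized_gronwall (T b α β : ℝ) (hT : 0 < T) (hα : 0 < α) (hβ : 0 < β)
    (hb : 0 ≤ b) :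
    ∃ c > (0:ℝ), ∀ a : ℝ, 0 ≤ a → ∀ φ : ℝ → ℝ,
      ContinuousOn φ (Ioc 0 T) →
      (∀ t ∈ Ioc (0:ℝ) T, 0 ≤ φ t) →
      IntegrableOn φ (Ioo 0 T) →
      (∀ t ∈ Ioc (0:ℝ) T,
        φ t ≤ a * t ^ (α - 1) + b * ∫ s in Ioo (0:ℝ) t, (t - s) ^ (β - 1) * φ s) →
      ∀ t ∈ Ioc (0:ℝ) T, φ t ≤ c * a * t ^ (α - 1) := by
  obtain ⟨C, hC, hle⟩ := IsGronwallSubsolution.exists_le T hb hα hβ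
  refine ⟨C.toReal + 1, by positivity, fun a ha φ hφ hφ_nonneg hφ_int h t ht ↦ ?_⟩
  have hsub := isGronwallSubsolution_indicator_ofReal hb ha hφ hφ_nonneg hφ_int h
  have ht0 := ht.1
  have key := hle _ _ hsub t ht
  rw [indicator_of_mem ht, powKernel_of_pos ht0, ← ENNReal.ofReal_toReal hC,
    ← ENNReal.ofReal_mul (by positivity), ← ENNReal.ofReal_mul (by positivity),
    ENNReal.ofReal_le_ofReal_iff (by positivity)] at key
  refine key.trans ?_
  gcongr
  linarith
end

section
/- For every θ ∈ (π/2, π) there exists a constant c > 0, depending only on θ, such that for every τ > 0 and every t ≥ 0: ∫_{1/(t+τ)}^{π/(τ·sin θ)} e^(s·t·cos θ) ds ≤ c·(t + τ)^(−1). -/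
open MeasureTheory

/-- The core integral bound behind the smoothing property of the fully
discrete backward Euler operator: `∫ e^{st cos θ} ds ≤ c (t+τ)⁻¹` over the
truncated range. -/
theorem discrete_smoothing_integral (θ : ℝ) (hθ : θ ∈ Set.Ioo (Real.pi / 2) Real.pi) :
    ∃ c > (0:ℝ), ∀ τ : ℝ, 0 < τ → ∀ t : ℝ, 0 ≤ t →
      (∫ s in Set.Ioc (1 / (t + τ)) (Real.pi / (τ * Real.sin θ)),
          Real.exp (s * t * Real.cos θ)) ≤ c * (t + τ)⁻¹ := by
  have hsin : 0 < Real.sin θ :=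
    Real.sin_pos_of_pos_of_lt_pi (by linarith [hθ.1, Real.pi_pos]) hθ.2
  have hcos : Real.cos θ < 0 :=
    Real.cos_neg_of_pi_div_two_lt_of_lt hθ.1 (by linarith [hθ.2, Real.pi_pos])
  set C := Real.exp (-Real.cos θ * (Real.pi / Real.sin θ)) with hC
  refine ⟨C / -Real.cos θ, div_pos (Real.exp_pos _) (neg_pos.2 hcos), fun τ hτ t ht => ?_⟩
  have htτ : 0 < t + τ := by linarith
  have ha : Real.cos θ * (t + τ) < 0 := mul_neg_of_neg_of_pos hcos htτ
  have hint : IntegrableOn (fun s => C * Real.exp (Real.cos θ * (t + τ) * s)) (Set.Ioi 0) :=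
    (integrableOn_exp_mul_Ioi ha 0).const_mul C
  have hsub : Set.Ioc (1 / (t + τ)) (Real.pi / (τ * Real.sin θ)) ⊆ Set.Ioi 0 :=
    fun s hs => (by positivity : 0 < 1 / (t + τ)).trans hs.1
  calc
    _ ≤ ∫ s in Set.Ioc (1 / (t + τ)) (Real.pi / (τ * Real.sin θ)),
          C * Real.exp (Real.cos θ * (t + τ) * s) := by
      refine setIntegral_mono_on ?_ (hint.mono_set hsub) measurableSet_Ioc fun s hs => ?_
      · exact Continuous.integrableOn_Ioc (by fun_prop)
      · have hs' : s * τ ≤ Real.pi / Real.sin θ := by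
          have := (le_div_iff₀ (mul_pos hτ hsin)).1 hs.2
          rw [le_div_iff₀ hsin]
          linarith
        rw [hC, ← Real.exp_add, Real.exp_le_exp]
        nlinarith
    _ ≤ ∫ s in Set.Ioi 0, C * Real.exp (Real.cos θ * (t + τ) * s) :=
      setIntegral_mono_set hint (ae_of_all _ fun s => by positivity) hsub.eventuallyLE
    _ = C / -Real.cos θ * (t + τ)⁻¹ := by
      rw [integral_const_mul, integral_exp_mul_Ioi ha]
      have := hcos.ne
      simp only [mul_zero, Real.exp_zero]
      field_simp
end
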